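/- arXiv:2102.09988 — 4 statements merged into one kernel-verified Lean document; each statement's English description precedes it below -/
import Mathlib

section
/- For every η, τ, λ, ω ∈ ℝ and each choice of sign, one has M^±_{η,τ,λ,ω} · ( ∓i(σ·n) + ½(η I₂ − τ σ₃ − λ(σ·t) − ω(σ·n)) ) = ¼(4 + d − ω² ∓ 4ωi) · I₂, where d := η² − τ² − λ². In particular, if (d, ω) ≠ (−4, 0) then the matrices M^+_{η,τ,λ,ω} and M^−_{η,τ,λ,ω} are invertible. -/
open Matrix

noncomputable def σ1 : Matrix (Fin 2) (Fin 2) ℂ := !![0, 1; 1, 0]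
noncomputable def σ2 : Matrix (Fin 2) (Fin 2) ℂ := !![0, -Complex.I; Complex.I, 0]
noncomputable def σ3 : Matrix (Fin 2) (Fin 2) ℂ := !![1, 0; 0, -1]

/-- `σ · v = v₁ σ₁ + v₂ σ₂` for a real vector `v`. -/
noncomputable def σdot (v : ℝ × ℝ) : Matrix (Fin 2) (Fin 2) ℂ :=
  (v.1 : ℂ) • σ1 + (v.2 : ℂ) • σ2

/-- The tangent vector `t = (−n₂, n₁)` associated with the normal `n`. -/
def tvec (n : ℝ × ℝ) : ℝ × ℝ := (-n.2, n.1)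

/-- The matrix `M^±_{η,τ,λ,ω} = ± i (σ·n) + ½(η I₂ + τ σ₃ + λ (σ·t) + ω (σ·n))`,
where the sign is encoded by `ε ∈ {1, −1}`. -/
noncomputable def Mmat (ε : ℂ) (n : ℝ × ℝ) (η τ l ω : ℝ) : Matrix (Fin 2) (Fin 2) ℂ :=
  ε • (Complex.I • σdot n) +
    (1 / 2 : ℂ) • ((η : ℂ) • (1 : Matrix (Fin 2) (Fin 2) ℂ) + (τ : ℂ) • σ3
      + (l : ℂ) • σdot (tvec n) + (ω : ℂ) • σdot n)

theorem Mmat_mul_conj {n : ℝ × ℝ} (hn : n.1 ^ 2 + n.2 ^ 2 = 1) (η τ l ω : ℝ) {ε : ℂ}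
    (hε : ε ^ 2 = 1) :
    Mmat ε n η τ l ω *
        ((-ε) • (Complex.I • σdot n) +
          (1 / 2 : ℂ) • ((η : ℂ) • (1 : Matrix (Fin 2) (Fin 2) ℂ) - (τ : ℂ) • σ3
            - (l : ℂ) • σdot (tvec n) - (ω : ℂ) • σdot n))
      = ((1 / 4 : ℂ) * (4 + ((η ^ 2 - τ ^ 2 - l ^ 2 : ℝ) : ℂ) - (ω : ℂ) ^ 2
            - ε * (4 * (ω : ℂ) * Complex.I))) • (1 : Matrix (Fin 2) (Fin 2) ℂ) := by
  have hI : Complex.I ^ 2 = -1 := Complex.I_sq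
  obtain ⟨a, ha⟩ : ∃ a : ℂ, a = n.1 - Complex.I * n.2 := ⟨_, rfl⟩
  obtain ⟨b, hb⟩ : ∃ b : ℂ, b = n.1 + Complex.I * n.2 := ⟨_, rfl⟩
  have hab : a * b = 1 := by
    have hn' : (n.1 : ℂ) ^ 2 + (n.2 : ℂ) ^ 2 = 1 := by exact_mod_cast hn
    rw [ha, hb]
    linear_combination hn' - (n.2 : ℂ) ^ 2 * hI
  have hσn : σdot n = !![0, a; b, 0] := by
    ext i j
    fin_cases i <;> fin_cases j <;> simp [σdot, σ1, σ2, ha, hb] <;> ring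
  have hσt : σdot (tvec n) = !![0, -Complex.I * a; Complex.I * b, 0] := by
    ext i j
    fin_cases i <;> fin_cases j <;> simp [σdot, tvec, σ1, σ2, ha, hb]
    · linear_combination -(n.2 : ℂ) * hI
    · linear_combination -(n.2 : ℂ) * hI
  rw [Mmat, hσn, hσt, σ3, Matrix.one_fin_two]
  simp only [Matrix.smul_of, Matrix.smul_cons, Matrix.smul_empty, Matrix.of_add_of,
    Matrix.of_sub_of, Matrix.add_cons, Matrix.sub_cons, Matrix.head_cons, Matrix.tail_cons,
    Matrix.empty_add_empty, Matrix.empty_sub_empty, Matrix.mul_fin_two, smul_eq_mul]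
  push_cast
  ext i j
  fin_cases i <;> fin_cases j <;> simp only [Fin.zero_eta, Fin.mk_one, Matrix.of_apply,
    Matrix.cons_val_zero, Matrix.cons_val_one, Matrix.cons_val', Matrix.cons_val_fin_one]
  · linear_combination
      ((Complex.I * l / 2) ^ 2 - (ε * Complex.I + ω / 2) ^ 2) * hab
        + ((l : ℂ) ^ 2 / 4 - ε ^ 2) * hI + hε
  · ring
  · ring
  · linear_combination
      ((Complex.I * l / 2) ^ 2 - (ε * Complex.I + ω / 2) ^ 2) * hab
        + ((l : ℂ) ^ 2 / 4 - ε ^ 2) * hI + hε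

theorem Matrix.isUnit_of_mul_eq_smul_one {m K : Type*} [Fintype m] [DecidableEq m] [Field K]
    {A B : Matrix m m K} {c : K} (hc : c ≠ 0) (h : A * B = c • (1 : Matrix m m K)) :
    IsUnit A := by
  refine IsUnit.of_mul_eq_one (c⁻¹ • B) ?_
  rw [Matrix.mul_smul, h, smul_smul, inv_mul_cancel₀ hc, one_smul]

theorem Mmat_mul_conj_scalar_ne_zero {d ω : ℝ} (h : (d, ω) ≠ ((-4 : ℝ), (0 : ℝ))) {ε : ℂ}
    (hε : ε = 1 ∨ ε = -1) :
    (1 / 4 : ℂ) * (4 + (d : ℂ) - (ω : ℂ) ^ 2 - ε * (4 * (ω : ℂ) * Complex.I)) ≠ 0 := by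
  intro h0
  apply h
  have hre := congrArg Complex.re h0
  have him := congrArg Complex.im h0
  have hω : ω = 0 := by
    rcases hε with rfl | rfl <;> simpa [pow_two] using him
  subst hω
  have hd : 4 + d = 0 := by simpa using hre
  exact Prod.ext (by simp only; linarith) rfl

theorem stmt_2 (n : ℝ × ℝ) (hn : n.1 ^ 2 + n.2 ^ 2 = 1) (η τ l ω : ℝ) :
    (∀ ε : ℂ, (ε = 1 ∨ ε = -1) →
      Mmat ε n η τ l ω *
        ((-ε) • (Complex.I • σdot n) +
          (1 / 2 : ℂ) • ((η : ℂ) • (1 : Matrix (Fin 2) (Fin 2) ℂ) - (τ : ℂ) • σ3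
            - (l : ℂ) • σdot (tvec n) - (ω : ℂ) • σdot n))
        = ((1 / 4 : ℂ) * (4 + ((η ^ 2 - τ ^ 2 - l ^ 2 : ℝ) : ℂ) - (ω : ℂ) ^ 2
            - ε * (4 * (ω : ℂ) * Complex.I))) • (1 : Matrix (Fin 2) (Fin 2) ℂ)) ∧
    ((η ^ 2 - τ ^ 2 - l ^ 2, ω) ≠ ((-4 : ℝ), (0 : ℝ)) →
      IsUnit (Mmat 1 n η τ l ω) ∧ IsUnit (Mmat (-1) n η τ l ω)) := by
  refine ⟨fun ε hε => Mmat_mul_conj hn η τ l ω (sq_eq_one_iff.mpr hε), fun h => ?_⟩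
  have hunit (ε : ℂ) (hε : ε = 1 ∨ ε = -1) : IsUnit (Mmat ε n η τ l ω) :=
    Matrix.isUnit_of_mul_eq_smul_one (Mmat_mul_conj_scalar_ne_zero h hε)
      (Mmat_mul_conj hn η τ l ω (sq_eq_one_iff.mpr hε))
  exact ⟨hunit 1 (.inl rfl), hunit (-1) (.inr rfl)⟩
end

section
/- Let η, τ, λ, ω ∈ ℝ, d := η² − τ² − λ², and assume (d, ω) ≠ (−4, 0). Then for each choice of sign, (M^±_{η,τ,λ,ω})⁻¹ · M^∓_{η,τ,λ,ω} = (4/(4 + d − ω² ∓ 4ωi)) · ( ((−4 + d − ω²)/4) I₂ ± ( λ σ₃ − η i(σ·n) − τ(σ·t) ) ). -/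
open Matrix

theorem det_Mmat {ε : ℂ} (hε : ε ^ 2 = 1) {n : ℝ × ℝ} (hn : n.1 ^ 2 + n.2 ^ 2 = 1)
    (η τ l ω : ℝ) :
    (Mmat ε n η τ l ω).det = (4 + ((η ^ 2 - τ ^ 2 - l ^ 2 : ℝ) : ℂ) - (ω : ℂ) ^ 2
      - ε * (4 * (ω : ℂ) * Complex.I)) / 4 := by
  have hn' : (n.1 : ℂ) ^ 2 + (n.2 : ℂ) ^ 2 = 1 := mod_cast hn
  have hI : Complex.I ^ 2 = -1 := Complex.I_sq
  simp [Mmat, σdot, tvec, σ1, σ2, σ3, Matrix.det_fin_two]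
  grind

theorem adjugate_Mmat_mul_Mmat_neg {ε : ℂ} (hε : ε ^ 2 = 1) {n : ℝ × ℝ}
    (hn : n.1 ^ 2 + n.2 ^ 2 = 1) (η τ l ω : ℝ) :
    (Mmat ε n η τ l ω).adjugate * Mmat (-ε) n η τ l ω
      = ((-4 + ((η ^ 2 - τ ^ 2 - l ^ 2 : ℝ) : ℂ) - (ω : ℂ) ^ 2) / 4) •
            (1 : Matrix (Fin 2) (Fin 2) ℂ)
          + ε • ((l : ℂ) • σ3 - (η : ℂ) • (Complex.I • σdot n) - (τ : ℂ) • σdot (tvec n)) := by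
  have hn' : (n.1 : ℂ) ^ 2 + (n.2 : ℂ) ^ 2 = 1 := mod_cast hn
  have hI : Complex.I ^ 2 = -1 := Complex.I_sq
  ext i j
  fin_cases i <;> fin_cases j <;>
    simp [Mmat, σdot, tvec, σ1, σ2, σ3, Matrix.adjugate_fin_two, Matrix.mul_apply] <;>
    grind

theorem inv_Mmat_mul_Mmat_neg {ε : ℂ} (hε : ε ^ 2 = 1) {n : ℝ × ℝ}
    (hn : n.1 ^ 2 + n.2 ^ 2 = 1) (η τ l ω : ℝ) :
    (Mmat ε n η τ l ω)⁻¹ * Mmat (-ε) n η τ l ω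
      = ((4 : ℂ) / (4 + ((η ^ 2 - τ ^ 2 - l ^ 2 : ℝ) : ℂ) - (ω : ℂ) ^ 2
            - ε * (4 * (ω : ℂ) * Complex.I))) •
          (((-4 + ((η ^ 2 - τ ^ 2 - l ^ 2 : ℝ) : ℂ) - (ω : ℂ) ^ 2) / 4) •
              (1 : Matrix (Fin 2) (Fin 2) ℂ)
            + ε • ((l : ℂ) • σ3 - (η : ℂ) • (Complex.I • σdot n)
              - (τ : ℂ) • σdot (tvec n))) := by
  rw [Matrix.inv_def, smul_mul_assoc, adjugate_Mmat_mul_Mmat_neg hε hn, det_Mmat hε hn,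
    Ring.inverse_eq_inv', inv_div]

theorem stmt_3 (n : ℝ × ℝ) (hn : n.1 ^ 2 + n.2 ^ 2 = 1) (η τ l ω : ℝ)
    (hne : (η ^ 2 - τ ^ 2 - l ^ 2, ω) ≠ ((-4 : ℝ), (0 : ℝ))) :
    (Mmat 1 n η τ l ω)⁻¹ * Mmat (-1) n η τ l ω
      = ((4 : ℂ) / (4 + ((η ^ 2 - τ ^ 2 - l ^ 2 : ℝ) : ℂ) - (ω : ℂ) ^ 2
            - 4 * (ω : ℂ) * Complex.I)) •
          (((-4 + ((η ^ 2 - τ ^ 2 - l ^ 2 : ℝ) : ℂ) - (ω : ℂ) ^ 2) / 4) •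
              (1 : Matrix (Fin 2) (Fin 2) ℂ)
            + ((l : ℂ) • σ3 - (η : ℂ) • (Complex.I • σdot n) - (τ : ℂ) • σdot (tvec n))) ∧
    (Mmat (-1) n η τ l ω)⁻¹ * Mmat 1 n η τ l ω
      = ((4 : ℂ) / (4 + ((η ^ 2 - τ ^ 2 - l ^ 2 : ℝ) : ℂ) - (ω : ℂ) ^ 2
            + 4 * (ω : ℂ) * Complex.I)) •
          (((-4 + ((η ^ 2 - τ ^ 2 - l ^ 2 : ℝ) : ℂ) - (ω : ℂ) ^ 2) / 4) •
              (1 : Matrix (Fin 2) (Fin 2) ℂ)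
            - ((l : ℂ) • σ3 - (η : ℂ) • (Complex.I • σdot n) - (τ : ℂ) • σdot (tvec n))) := by
  constructor
  · simpa using inv_Mmat_mul_Mmat_neg (ε := 1) (by norm_num) hn η τ l ω
  · have h := inv_Mmat_mul_Mmat_neg (ε := -1) (by norm_num) hn η τ l ω
    rwa [neg_neg, neg_one_mul, sub_neg_eq_add, neg_one_smul, ← sub_eq_add_neg] at h
end

section
/- Let η, τ, λ ∈ ℝ with d := η² − τ² − λ² ≠ −4, and let M := −(i/2)(σ·n)(η I₂ + τ σ₃ + λ(σ·t)). Then I₂ + M is invertible with (I₂ + M)⁻¹ = (4/(4 + d))(I₂ − M), and the matrix R_{η,τ,λ} := (I₂ + M)⁻¹(I₂ − M) satisfies R_{η,τ,λ} = (4/(4 + d)) · ( ((4 − d)/4) I₂ + i η (σ·n) + τ (σ·t) − λ σ₃ ). -/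
open Matrix

theorem σdot_mul_potential (n : ℝ × ℝ) (hn : n.1 ^ 2 + n.2 ^ 2 = 1) (a b c : ℂ) :
    σdot n * (a • (1 : Matrix (Fin 2) (Fin 2) ℂ) + b • σ3 + c • σdot (tvec n))
      = a • σdot n - (Complex.I * b) • σdot (tvec n) + (Complex.I * c) • σ3 := by
  have hn' : (n.1 : ℂ) ^ 2 + (n.2 : ℂ) ^ 2 = 1 := by exact_mod_cast hn
  have hI := Complex.I_sq
  ext i j
  fin_cases i <;> fin_cases j <;>
    simp [σdot, tvec, σ1, σ2, σ3, Matrix.mul_apply, Fin.sum_univ_two] <;> grind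

theorem pauli_combination_mul_self (n : ℝ × ℝ) (hn : n.1 ^ 2 + n.2 ^ 2 = 1) (a b c : ℂ) :
    (a • σdot n + b • σdot (tvec n) + c • σ3) * (a • σdot n + b • σdot (tvec n) + c • σ3)
      = (a ^ 2 + b ^ 2 + c ^ 2) • (1 : Matrix (Fin 2) (Fin 2) ℂ) := by
  have hn' : (n.1 : ℂ) ^ 2 + (n.2 : ℂ) ^ 2 = 1 := by exact_mod_cast hn
  have hI := Complex.I_sq
  ext i j
  fin_cases i <;> fin_cases j <;>
    simp [σdot, tvec, σ1, σ2, σ3, Matrix.mul_apply, Fin.sum_univ_two] <;> grind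

theorem stmt_6 (n : ℝ × ℝ) (hn : n.1 ^ 2 + n.2 ^ 2 = 1) (η τ l : ℝ)
    (hd : η ^ 2 - τ ^ 2 - l ^ 2 ≠ -4)
    (M : Matrix (Fin 2) (Fin 2) ℂ)
    (hM : M = (-(Complex.I / 2)) •
      (σdot n * ((η : ℂ) • (1 : Matrix (Fin 2) (Fin 2) ℂ) + (τ : ℂ) • σ3
        + (l : ℂ) • σdot (tvec n)))) :
    IsUnit (1 + M) ∧
    (1 + M)⁻¹ = ((4 : ℂ) / (4 + ((η ^ 2 - τ ^ 2 - l ^ 2 : ℝ) : ℂ))) • (1 - M) ∧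
    (1 + M)⁻¹ * (1 - M)
      = ((4 : ℂ) / (4 + ((η ^ 2 - τ ^ 2 - l ^ 2 : ℝ) : ℂ))) •
          (((4 - ((η ^ 2 - τ ^ 2 - l ^ 2 : ℝ) : ℂ)) / 4) • (1 : Matrix (Fin 2) (Fin 2) ℂ)
            + (η : ℂ) • (Complex.I • σdot n) + (τ : ℂ) • σdot (tvec n) - (l : ℂ) • σ3) := by
  have hM' : M = (-(Complex.I / 2) * η) • σdot n + (-(τ : ℂ) / 2) • σdot (tvec n)
      + ((l : ℂ) / 2) • σ3 := by
    rw [hM, σdot_mul_potential n hn]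
    have hI := Complex.I_mul_I
    match_scalars <;> grind
  set d : ℂ := ((η ^ 2 - τ ^ 2 - l ^ 2 : ℝ) : ℂ) with hd_def
  have hd4 : 4 + d ≠ 0 := by
    intro h
    apply hd
    have h' : d = ((-4 : ℝ) : ℂ) := by
      push_cast
      linear_combination h
    exact Complex.ofReal_injective h'
  have hMM : M * M = (-d / 4) • (1 : Matrix (Fin 2) (Fin 2) ℂ) := by
    rw [hM', pauli_combination_mul_self n hn]
    congr 1
    rw [hd_def]
    push_cast
    linear_combination ((η : ℂ) ^ 2 / 4) * Complex.I_sq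
  have hinv : (1 + M) * ((4 / (4 + d)) • (1 - M)) = 1 := by
    have h : (1 + M) * (1 - M) = 1 - M * M := by noncomm_ring
    rw [mul_smul_comm, h, hMM]
    match_scalars
    field_simp
    ring
  have hinv_eq : (1 + M)⁻¹ = (4 / (4 + d)) • (1 - M) := Matrix.inv_eq_right_inv hinv
  refine ⟨IsUnit.of_mul_eq_one _ hinv, hinv_eq, ?_⟩
  have h : (1 - M) * (1 - M) = 1 - (2 : ℂ) • M + M * M := by
    rw [two_smul]
    noncomm_ring
  rw [hinv_eq, smul_mul_assoc, h, hMM, hM']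
  congr 1
  match_scalars <;> ring
end

section
/- Let η, τ, λ ∈ ℝ with d := η² − τ² − λ² = −4, and let M := −(i/2)(σ·n)(η I₂ + τ σ₃ + λ(σ·t)). Then for all vectors u, v ∈ ℂ², the equation (I₂ + M)u = (I₂ − M)v holds if and only if (I₂ + M)u = 0 and (I₂ − M)v = 0. -/
open Matrix

/-- If `M` is an involution, then the ranges of `1 + M` and `1 - M` intersect trivially. -/
theorem Matrix.one_add_mulVec_eq_one_sub_mulVec_iff {ι K : Type*} [Fintype ι] [DecidableEq ι]
    [Field K] [NeZero (2 : K)] {M : Matrix ι ι K} (hM : M * M = 1) (u v : ι → K) :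
    (1 + M).mulVec u = (1 - M).mulVec v ↔
      ((1 + M).mulVec u = 0 ∧ (1 - M).mulVec v = 0) := by
  refine ⟨fun h => ?_, fun h => h.1.trans h.2.symm⟩
  have hsq : (1 + M) * (1 + M) = (2 : K) • (1 + M) := by
    rw [two_smul, add_mul, mul_add, mul_add, hM]
    simp only [one_mul, mul_one]
    abel
  have hmul : (1 + M) * (1 - M) = 0 := by
    rw [add_mul, mul_sub, mul_sub, hM]
    simp
  have hu : (1 + M).mulVec u = 0 := by
    have h2 := congrArg (1 + M).mulVec h
    rw [mulVec_mulVec, mulVec_mulVec, hsq, hmul, zero_mulVec, smul_mulVec] at h2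
    exact (smul_eq_zero.mp h2).resolve_left two_ne_zero
  exact ⟨hu, h ▸ hu⟩

theorem stmt_7 (n : ℝ × ℝ) (hn : n.1 ^ 2 + n.2 ^ 2 = 1) (η τ l : ℝ)
    (hd : η ^ 2 - τ ^ 2 - l ^ 2 = -4)
    (M : Matrix (Fin 2) (Fin 2) ℂ)
    (hM : M = (-(Complex.I / 2)) •
      (σdot n * ((η : ℂ) • (1 : Matrix (Fin 2) (Fin 2) ℂ) + (τ : ℂ) • σ3
        + (l : ℂ) • σdot (tvec n)))) :
    ∀ u v : Fin 2 → ℂ,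
      (1 + M).mulVec u = (1 - M).mulVec v ↔
        ((1 + M).mulVec u = 0 ∧ (1 - M).mulVec v = 0) := by
  have hn' : (n.1 : ℂ) ^ 2 + (n.2 : ℂ) ^ 2 = 1 := by exact_mod_cast hn
  have hd' : (η : ℂ) ^ 2 - (τ : ℂ) ^ 2 - (l : ℂ) ^ 2 = -4 := by exact_mod_cast hd
  have hI : Complex.I ^ 2 = -1 := Complex.I_sq
  refine Matrix.one_add_mulVec_eq_one_sub_mulVec_iff ?_
  have hS : σdot n * σdot n = 1 := by
    ext i j
    fin_cases i <;> fin_cases j <;> simp [σdot, σ1, σ2, Matrix.mul_apply, Fin.sum_univ_two] <;>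
      grind
  have hconj : σdot n * ((η : ℂ) • (1 : Matrix (Fin 2) (Fin 2) ℂ) + (τ : ℂ) • σ3
        + (l : ℂ) • σdot (tvec n)) = ((η : ℂ) • (1 : Matrix (Fin 2) (Fin 2) ℂ) - (τ : ℂ) • σ3
        - (l : ℂ) • σdot (tvec n)) * σdot n := by
    ext i j
    fin_cases i <;> fin_cases j <;>
      simp [σdot, tvec, σ1, σ2, σ3, Matrix.mul_apply, Fin.sum_univ_two] <;> grind
  have hprod : ((η : ℂ) • (1 : Matrix (Fin 2) (Fin 2) ℂ) - (τ : ℂ) • σ3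
        - (l : ℂ) • σdot (tvec n)) * ((η : ℂ) • (1 : Matrix (Fin 2) (Fin 2) ℂ) + (τ : ℂ) • σ3
        + (l : ℂ) • σdot (tvec n)) = (-4 : ℂ) • 1 := by
    ext i j
    fin_cases i <;> fin_cases j <;>
      simp [σdot, tvec, σ1, σ2, σ3, Matrix.mul_apply, Fin.sum_univ_two] <;> grind
  have hcoef : -(Complex.I / 2) * -(Complex.I / 2) * (-4) = 1 := by
    linear_combination -hI
  rw [hM, smul_mul_smul_comm]
  nth_rewrite 1 [hconj]
  rw [Matrix.mul_assoc, ← Matrix.mul_assoc (σdot n) (σdot n), hS, Matrix.one_mul, hprod,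
    smul_smul, hcoef, one_smul]
end
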